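/- Let (𝒜, α) be a weighted system and let ρ(𝒜) denote the classical joint spectral radius of 𝒜 (all weights equal to 1). If ρ(𝒜) < 1, then ρ(𝒜)^{1/α_min} ≤ ρ(𝒜, α) ≤ ρ(𝒜)^{1/α_max}, where α_min and α_max denote the minimal and maximal weights. -/

import Mathlib

open Filter

attribute [local instance] Matrix.linftyOpNormedRing

/-- The product `A(k)⋯A(1)` associated with the word `w = (i_1, …, i_k)`. -/
noncomputable def wordProd {d m : ℕ} (A : Fin m → Matrix (Fin d) (Fin d) ℝ)
    (w : List (Fin m)) : Matrix (Fin d) (Fin d) ℝ :=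
  ((w.map A).reverse).prod

/-- The total weight `α(k)+⋯+α(1)` of the word `w = (i_1, …, i_k)`. -/
def wordWeight {m : ℕ} (α : Fin m → ℝ) (w : List (Fin m)) : ℝ :=
  (w.map α).sum

/-- `ρ_k`: the maximum of `‖A(k)⋯A(1)‖^(1/(α(k)+⋯+α(1)))` over products of length `k`. -/
noncomputable def rhoSeq {d m : ℕ} (A : Fin m → Matrix (Fin d) (Fin d) ℝ)
    (α : Fin m → ℝ) (k : ℕ) : ℝ :=
  sSup {r : ℝ | ∃ w : List (Fin m), w.length = k ∧
    r = ‖wordProd A w‖ ^ (1 / wordWeight α w)}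

/-- The `α`-weighted joint spectral radius `ρ(𝒜, α) = limsup_{k→∞} ρ_k`. -/
noncomputable def wjsr {d m : ℕ} (A : Fin m → Matrix (Fin d) (Fin d) ℝ)
    (α : Fin m → ℝ) : ℝ :=
  limsup (rhoSeq A α) atTop

/-- The set whose supremum is `rhoSeq A α k` is finite. -/
theorem finite_rhoSeq_set {d m : ℕ} (A : Fin m → Matrix (Fin d) (Fin d) ℝ)
    (α : Fin m → ℝ) (k : ℕ) :
    {r : ℝ | ∃ w : List (Fin m), w.length = k ∧
      r = ‖wordProd A w‖ ^ (1 / wordWeight α w)}.Finite := by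
  refine ((List.finite_length_eq (Fin m) k).image
    fun w => ‖wordProd A w‖ ^ (1 / wordWeight α w)).subset ?_
  rintro r ⟨w, hw, rfl⟩
  exact ⟨w, hw, rfl⟩

theorem le_rhoSeq {d m : ℕ} (A : Fin m → Matrix (Fin d) (Fin d) ℝ)
    (α : Fin m → ℝ) (w : List (Fin m)) :
    ‖wordProd A w‖ ^ (1 / wordWeight α w) ≤ rhoSeq A α w.length :=
  le_csSup (finite_rhoSeq_set A α _).bddAbove ⟨w, rfl, rfl⟩

theorem exists_word_rhoSeq_eq {d m : ℕ} (hm : 0 < m) (A : Fin m → Matrix (Fin d) (Fin d) ℝ)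
    (α : Fin m → ℝ) (k : ℕ) :
    ∃ w : List (Fin m), w.length = k ∧
      rhoSeq A α k = ‖wordProd A w‖ ^ (1 / wordWeight α w) :=
  Set.Nonempty.csSup_mem
    (s := {r : ℝ | ∃ w : List (Fin m), w.length = k ∧
      r = ‖wordProd A w‖ ^ (1 / wordWeight α w)})
    ⟨_, List.replicate k ⟨0, hm⟩, List.length_replicate, rfl⟩ (finite_rhoSeq_set A α k)

theorem rhoSeq_nonneg {d m : ℕ} (A : Fin m → Matrix (Fin d) (Fin d) ℝ)
    (α : Fin m → ℝ) (k : ℕ) : 0 ≤ rhoSeq A α k := by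
  refine Real.sSup_nonneg ?_
  rintro r ⟨w, -, rfl⟩
  positivity

theorem wordWeight_one {m : ℕ} (w : List (Fin m)) :
    wordWeight (fun _ => 1) w = w.length := by
  simp [wordWeight]

theorem length_mul_le_wordWeight {m : ℕ} {α : Fin m → ℝ} {a : ℝ} (ha : ∀ i, a ≤ α i)
    (w : List (Fin m)) : w.length * a ≤ wordWeight α w := by
  simpa [wordWeight] using List.card_nsmul_le_sum (w.map α) a (by simpa using fun i _ => ha i)

theorem wordWeight_le_length_mul {m : ℕ} {α : Fin m → ℝ} {b : ℝ} (hb : ∀ i, α i ≤ b)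
    (w : List (Fin m)) : wordWeight α w ≤ w.length * b := by
  simpa [wordWeight] using List.sum_le_card_nsmul (w.map α) b (by simpa using fun i _ => hb i)

theorem norm_wordProd_le_pow {d m : ℕ} {A : Fin m → Matrix (Fin d) (Fin d) ℝ} {M : ℝ}
    (hM : ∀ i, ‖A i‖ ≤ M) (w : List (Fin m)) (hw : w ≠ []) :
    ‖wordProd A w‖ ≤ M ^ w.length := by
  have hne : (w.map A).reverse ≠ [] := by simpa using hw
  refine (List.norm_prod_le' hne).trans ?_
  rw [List.map_reverse, List.prod_reverse, List.map_map]
  calc (w.map (norm ∘ A)).prod ≤ (w.map fun _ => M).prod :=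
        List.prod_map_le_prod_map₀ _ _ (fun i _ => norm_nonneg (A i)) fun i _ => hM i
    _ = M ^ w.length := by simp

theorem isBoundedUnder_rhoSeq_one {d m : ℕ} (hm : 0 < m)
    (A : Fin m → Matrix (Fin d) (Fin d) ℝ) :
    IsBoundedUnder (· ≤ ·) atTop (rhoSeq A fun _ => 1) := by
  obtain ⟨M, hM⟩ := (Set.finite_range fun i => ‖A i‖).bddAbove
  have hM' : ∀ i, ‖A i‖ ≤ M := fun i => hM ⟨i, rfl⟩
  have hM0 : 0 ≤ M := (norm_nonneg _).trans (hM' ⟨0, hm⟩)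
  refine ⟨M, eventually_map.2 ?_⟩
  filter_upwards [eventually_ge_atTop 1] with k hk
  obtain ⟨w, rfl, hw⟩ := exists_word_rhoSeq_eq hm A (fun _ => 1) k
  have hk0 : w.length ≠ 0 := by omega
  rw [hw, wordWeight_one, one_div]
  calc ‖wordProd A w‖ ^ (w.length : ℝ)⁻¹ ≤ (M ^ w.length) ^ (w.length : ℝ)⁻¹ := by
        have := norm_wordProd_le_pow hM' w (by simpa using hk0)
        gcongr
    _ = M := Real.pow_rpow_inv_natCast hM0 hk0

theorem limsup_rpow {u : ℕ → ℝ} (hu : ∀ k, 0 ≤ u k)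
    (hbdd : IsBoundedUnder (· ≤ ·) atTop u) {p : ℝ} (hp : 0 ≤ p) :
    limsup (fun k => u k ^ p) atTop = limsup u atTop ^ p := by
  have hbelow : IsBoundedUnder (· ≥ ·) atTop u := isBoundedUnder_of ⟨0, hu⟩
  have hmono : Monotone fun x : ℝ => max x 0 ^ p := fun x y hxy => by
    dsimp only
    gcongr
  have hcont : Continuous fun x : ℝ => max x 0 ^ p :=
    (continuous_id.max continuous_const).rpow_const fun _ => Or.inr hp
  have hlim : 0 ≤ limsup u atTop :=
    le_limsup_of_frequently_le (Frequently.of_forall hu) hbdd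
  have := hmono.map_limsup_of_continuousAt u hcont.continuousAt hbdd hbelow.isCoboundedUnder_flip
  simpa [Function.comp_def, hu, hlim] using this.symm

theorem norm_wordProd_le_one {d m : ℕ} {A : Fin m → Matrix (Fin d) (Fin d) ℝ}
    {w : List (Fin m)} (hw : 0 < w.length) (h : rhoSeq A (fun _ => 1) w.length ≤ 1) :
    ‖wordProd A w‖ ≤ 1 := by
  have h1 := (le_rhoSeq A (fun _ => 1) w).trans h
  rw [wordWeight_one] at h1
  by_contra! hgt
  exact h1.not_gt (Real.one_lt_rpow hgt (by positivity))

theorem rhoSeq_one_rpow_le {d m : ℕ} (hm : 0 < m) {A : Fin m → Matrix (Fin d) (Fin d) ℝ}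
    {α : Fin m → ℝ} {a : ℝ} (ha0 : 0 < a) (ha : ∀ i, a ≤ α i) {k : ℕ} (hk : 0 < k)
    (h : rhoSeq A (fun _ => 1) k ≤ 1) :
    rhoSeq A (fun _ => 1) k ^ (1 / a) ≤ rhoSeq A α k := by
  obtain ⟨w, rfl, hw⟩ := exists_word_rhoSeq_eq hm A (fun _ => 1) k
  refine le_trans ?_ (le_rhoSeq A α w)
  have hpos : 0 < w.length * a := by positivity
  have hle := length_mul_le_wordWeight ha w
  rw [hw, wordWeight_one, ← Real.rpow_mul (norm_nonneg _), one_div_mul_one_div]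
  exact Real.rpow_le_rpow_of_exponent_ge' (norm_nonneg _) (norm_wordProd_le_one hk h)
    (one_div_nonneg.2 (hpos.le.trans hle)) (one_div_le_one_div_of_le hpos hle)

theorem rhoSeq_le_rhoSeq_one_rpow {d m : ℕ} (hm : 0 < m)
    {A : Fin m → Matrix (Fin d) (Fin d) ℝ} {α : Fin m → ℝ} (hα : ∀ i, 0 < α i) {b : ℝ}
    (hb : ∀ i, α i ≤ b) {k : ℕ} (hk : 0 < k) (h : rhoSeq A (fun _ => 1) k ≤ 1) :
    rhoSeq A α k ≤ rhoSeq A (fun _ => 1) k ^ (1 / b) := by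
  obtain ⟨w, rfl, hw⟩ := exists_word_rhoSeq_eq hm A α k
  have hb0 : 0 < b := (hα ⟨0, hm⟩).trans_le (hb _)
  have hpos : 0 < wordWeight α w :=
    List.sum_pos _ (by simpa using fun i _ => hα i) (by simpa [List.length_pos_iff] using hk)
  calc rhoSeq A α w.length = ‖wordProd A w‖ ^ (1 / wordWeight α w) := hw
    _ ≤ ‖wordProd A w‖ ^ (1 / (w.length * b)) :=
        Real.rpow_le_rpow_of_exponent_ge' (norm_nonneg _) (norm_wordProd_le_one hk h)
          (by positivity) (one_div_le_one_div_of_le hpos (wordWeight_le_length_mul hb w))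
    _ = (‖wordProd A w‖ ^ (1 / wordWeight (fun _ => 1) w)) ^ (1 / b) := by
        rw [wordWeight_one, ← Real.rpow_mul (norm_nonneg _), one_div_mul_one_div]
    _ ≤ rhoSeq A (fun _ => 1) w.length ^ (1 / b) := by
        have := le_rhoSeq A (fun _ => 1) w
        gcongr

/-- If the classical joint spectral radius `ρ(𝒜)` is `< 1`, then
`ρ(𝒜)^{1/α_min} ≤ ρ(𝒜, α) ≤ ρ(𝒜)^{1/α_max}`. -/
theorem wjsr_bounds_of_jsr_lt_one {d m : ℕ} (hm : 0 < m)
    (A : Fin m → Matrix (Fin d) (Fin d) ℝ)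
    (α : Fin m → ℝ) (hα : ∀ i, 0 < α i)
    (h : wjsr A (fun _ => 1) < 1) :
    wjsr A (fun _ => 1) ^ (1 / ⨅ i, α i) ≤ wjsr A α ∧
      wjsr A α ≤ wjsr A (fun _ => 1) ^ (1 / ⨆ i, α i) := by
  have : Nonempty (Fin m) := ⟨⟨0, hm⟩⟩
  have hmin : ∀ i, ⨅ i, α i ≤ α i := ciInf_le (Set.finite_range α).bddBelow
  have hmax : ∀ i, α i ≤ ⨆ i, α i := le_ciSup (Set.finite_range α).bddAbove
  have hmin0 : 0 < ⨅ i, α i := by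
    obtain ⟨i, hi⟩ := exists_eq_ciInf_of_finite (f := α)
    exact hi ▸ hα i
  have hmax0 : 0 < ⨆ i, α i := (hα ⟨0, hm⟩).trans_le (hmax _)
  have hbdd := isBoundedUnder_rhoSeq_one hm A
  have hev : ∀ᶠ k in atTop, 0 < k ∧ rhoSeq A (fun _ => 1) k ≤ 1 :=
    (eventually_gt_atTop 0).and
      ((eventually_lt_of_limsup_lt h hbdd).mono fun _ => le_of_lt)
  have hlower : ∀ᶠ k in atTop,
      rhoSeq A (fun _ => 1) k ^ (1 / ⨅ i, α i) ≤ rhoSeq A α k :=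
    hev.mono fun _ hk => rhoSeq_one_rpow_le hm hmin0 hmin hk.1 hk.2
  have hupper : ∀ᶠ k in atTop,
      rhoSeq A α k ≤ rhoSeq A (fun _ => 1) k ^ (1 / ⨆ i, α i) :=
    hev.mono fun _ hk => rhoSeq_le_rhoSeq_one_rpow hm hα hmax hk.1 hk.2
  have hone : ∀ᶠ k in atTop, rhoSeq A (fun _ => 1) k ^ (1 / ⨆ i, α i) ≤ 1 :=
    hev.mono fun _ hk => Real.rpow_le_one (rhoSeq_nonneg _ _ _) hk.2 (by positivity)
  have hcobdd {u : ℕ → ℝ} (hu : ∀ k, 0 ≤ u k) : IsCoboundedUnder (· ≤ ·) atTop u :=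
    (isBoundedUnder_of (r := (· ≥ ·)) ⟨0, hu⟩).isCoboundedUnder_flip
  unfold wjsr
  rw [← limsup_rpow (rhoSeq_nonneg A _) hbdd (by positivity),
    ← limsup_rpow (rhoSeq_nonneg A _) hbdd (by positivity)]
  constructor
  · exact limsup_le_limsup hlower
      (hcobdd fun _ => Real.rpow_nonneg (rhoSeq_nonneg _ _ _) _)
      ⟨1, eventually_map.2 (hupper.and hone |>.mono fun _ hk => hk.1.trans hk.2)⟩
  · exact limsup_le_limsup hupper (hcobdd (rhoSeq_nonneg A α)) ⟨1, eventually_map.2 hone⟩
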